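/- Let ω ⊂ ℝ^{n-1} be a bounded convex Lipschitz domain, 0 < α < 1, and η ∈ C^{0,α}(ω̄) with η(x) ≥ η_min > 0. Let Ω_η = {(x, x_n) : x ∈ ω, 0 < x_n < η(x)}. Then for every u ∈ C¹_c(ℝ^n) and every 0 ≤ s < α, ∫₀¹ ∫_{ω×ω} |u(x₁, η(x₁)t) - u(x₂, η(x₂)t)|² / |x₁-x₂|^{n-1+2s} dx₁ dx₂ dt ≤ C ‖∇u‖²_{L²(Ω_η)}, where C depends only on ω, η, α, s. -/

import Mathlib

open Set MeasureTheory
open scoped ENNReal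

section Helpers

theorem sq_lintegral_le_lintegral_sq {X : Type*} [MeasurableSpace X] {μ : Measure X}
    [IsProbabilityMeasure μ] {f : X → ℝ≥0∞} (hf : AEMeasurable f μ) :
    (∫⁻ x, f x ∂μ) ^ 2 ≤ ∫⁻ x, f x ^ 2 ∂μ := by
  have h := ENNReal.lintegral_mul_le_Lp_mul_Lq μ Real.HolderConjugate.two_two hf
    (aemeasurable_const (b := (1 : ℝ≥0∞)))
  simp only [Pi.mul_apply, mul_one, ENNReal.one_rpow, lintegral_one, measure_univ] at h
  calc (∫⁻ x, f x ∂μ) ^ 2 ≤ ((∫⁻ x, f x ^ (2 : ℝ) ∂μ) ^ (1 / 2 : ℝ)) ^ 2 := by gcongr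
    _ = ∫⁻ x, f x ^ 2 ∂μ := by
      rw [← ENNReal.rpow_natCast, ← ENNReal.rpow_mul]
      norm_num

theorem enorm_sub_sq_le_lintegral_fderiv {V : Type*} [NormedAddCommGroup V] [NormedSpace ℝ V]
    {u : V → ℝ} (hu : ContDiff ℝ 1 u) (p q : V) :
    ‖u q - u p‖ₑ ^ 2 ≤
      ‖q - p‖ₑ ^ 2 * ∫⁻ r in Ioo (0 : ℝ) 1, ‖fderiv ℝ u (p + r • (q - p))‖ₑ ^ 2 := by
  have hcont : Continuous fun r : ℝ => fderiv ℝ u (p + r • (q - p)) :=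
    (hu.continuous_fderiv one_ne_zero).comp (by fun_prop)
  have hderiv : ∀ r : ℝ, HasDerivAt (fun r : ℝ => u (p + r • (q - p)))
      (fderiv ℝ u (p + r • (q - p)) (q - p)) r := fun r => by
    have h₁ : HasDerivAt (fun r : ℝ => p + r • (q - p)) (q - p) r := by
      simpa using ((hasDerivAt_id r).smul_const (q - p)).const_add p
    exact ((hu.differentiable one_ne_zero _).hasFDerivAt).comp_hasDerivAt r h₁
  have hftc := intervalIntegral.integral_eq_sub_of_hasDerivAt (a := 0) (b := 1)
    (fun r _ => hderiv r) ((hcont.clm_apply continuous_const).intervalIntegrable _ _)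
  simp only [one_smul, zero_smul, add_zero, add_sub_cancel] at hftc
  rw [intervalIntegral.integral_of_le zero_le_one, integral_Ioc_eq_integral_Ioo] at hftc
  have : IsProbabilityMeasure (volume.restrict (Ioo (0 : ℝ) 1)) := ⟨by simp⟩
  have hmeas : Measurable fun r : ℝ => ‖fderiv ℝ u (p + r • (q - p))‖ₑ :=
    hcont.enorm.measurable
  rw [← hftc]
  calc _ ≤ (∫⁻ r in Ioo (0 : ℝ) 1, ‖fderiv ℝ u (p + r • (q - p)) (q - p)‖ₑ) ^ 2 := by
        gcongr; exact enorm_integral_le_lintegral_enorm _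
    _ ≤ (∫⁻ r in Ioo (0 : ℝ) 1, ‖q - p‖ₑ * ‖fderiv ℝ u (p + r • (q - p))‖ₑ) ^ 2 := by
        gcongr with r
        rw [mul_comm]
        exact ContinuousLinearMap.le_opENorm _ _
    _ ≤ _ := by
        rw [lintegral_const_mul _ hmeas, mul_pow]
        gcongr
        exact sq_lintegral_le_lintegral_sq hmeas.aemeasurable

theorem lintegral_Ioo_comp_mul_le {f : ℝ → ℝ≥0∞} (hf : Measurable f) {c g b : ℝ} (hc : 0 < c)
    (hcg : c ≤ g) (hgb : g ≤ b) :
    ∫⁻ t in Ioo (0 : ℝ) 1, f (g * t) ≤ ENNReal.ofReal c⁻¹ * ∫⁻ y in Ioo 0 b, f y := by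
  have hg : 0 < g := hc.trans_le hcg
  have h₁ : ENNReal.ofReal g * ∫⁻ t in Ioo (0 : ℝ) 1, f (g * t) ≤ ∫⁻ y in Ioo 0 b, f y := by
    have hh : Measurable ((Ioo 0 b).indicator f) := hf.indicator measurableSet_Ioo
    rw [← lintegral_indicator measurableSet_Ioo, ← lintegral_indicator measurableSet_Ioo]
    conv_rhs => rw [← Real.smul_map_volume_mul_left hg.ne', abs_of_pos hg]
    rw [lintegral_smul_measure, lintegral_map hh (by fun_prop), smul_eq_mul]
    gcongr with t
    by_cases ht : t ∈ Ioo (0 : ℝ) 1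
    · have hgt : g * t ∈ Ioo 0 b := ⟨mul_pos hg ht.1, by nlinarith [ht.1, ht.2]⟩
      rw [indicator_of_mem ht, indicator_of_mem hgt]
    · simp [ht]
  calc ∫⁻ t in Ioo (0 : ℝ) 1, f (g * t)
      ≤ ENNReal.ofReal (c⁻¹ * g) * ∫⁻ t in Ioo (0 : ℝ) 1, f (g * t) := by
        refine le_mul_of_one_le_left zero_le (ENNReal.one_le_ofReal.2 ?_)
        rw [inv_mul_eq_div, one_le_div hc]; exact hcg
    _ ≤ _ := by
        rw [ENNReal.ofReal_mul (by positivity), mul_assoc]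
        gcongr

variable {E : Type*} [NormedAddCommGroup E] [InnerProductSpace ℝ E] [MeasurableSpace E]

/-- The Dirichlet energy of `u` on the vertical fibre `{x} × (0, η x)`. -/
noncomputable def fiberEnergy (u : WithLp 2 (E × ℝ) → ℝ) (η : E → ℝ) (x : E) : ℝ≥0∞ :=
  ∫⁻ y in Ioo 0 (η x), ‖fderiv ℝ u (WithLp.toLp 2 (x, y))‖ₑ ^ 2

variable [BorelSpace E]

theorem measurable_fderiv_toLp {u : WithLp 2 (E × ℝ) → ℝ} (hu : ContDiff ℝ 1 u) :
    Measurable fun p : E × ℝ => ‖fderiv ℝ u (WithLp.toLp 2 p)‖ₑ ^ 2 :=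
  (((hu.continuous_fderiv one_ne_zero).comp
    (WithLp.prod_continuous_toLp 2 E ℝ)).enorm.measurable).pow_const 2

theorem measurableSet_subgraph {E : Type*} [MeasurableSpace E] {η : E → ℝ} (hη : Measurable η) :
    MeasurableSet {p : E × ℝ | p.2 ∈ Ioo 0 (η p.1)} :=
  (measurableSet_lt measurable_const measurable_snd).inter
    (measurableSet_lt measurable_snd (hη.comp measurable_fst))

theorem measurable_fiberEnergy {u : WithLp 2 (E × ℝ) → ℝ} (hu : ContDiff ℝ 1 u) {η : E → ℝ}
    (hη : Measurable η) : Measurable (fiberEnergy u η) := by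
  have h := ((measurable_fderiv_toLp hu).indicator (measurableSet_subgraph hη)).lintegral_prod_right'
    (ν := volume)
  convert h using 2 with x
  rw [fiberEnergy, ← lintegral_indicator measurableSet_Ioo]
  rfl

theorem lintegral_fiberEnergy [FiniteDimensional ℝ E] {u : WithLp 2 (E × ℝ) → ℝ}
    (hu : ContDiff ℝ 1 u) {η : E → ℝ} (hη : Measurable η) {ω : Set E} (hω : MeasurableSet ω) :
    ∫⁻ x in ω, fiberEnergy u η x =
      ∫⁻ p in {p : E × ℝ | p.1 ∈ ω ∧ p.2 ∈ Ioo 0 (η p.1)},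
        ‖fderiv ℝ u (WithLp.toLp 2 p)‖ₑ ^ 2 := by
  have hΩ : MeasurableSet {p : E × ℝ | p.1 ∈ ω ∧ p.2 ∈ Ioo 0 (η p.1)} :=
    (measurable_fst hω).inter (measurableSet_subgraph hη)
  rw [← lintegral_indicator hω, ← lintegral_indicator hΩ, Measure.volume_eq_prod,
    lintegral_prod _ ((measurable_fderiv_toLp hu).indicator hΩ).aemeasurable]
  congr with x
  by_cases hx : x ∈ ω
  · rw [indicator_of_mem hx, fiberEnergy, ← lintegral_indicator measurableSet_Ioo]
    congr with y
    simp [indicator, hx]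
  · simp [indicator, hx]

/-- Estimate along the segments joining `(x, a t)` to `(y, b t)`, when the segment from `(x, a)` to
`(y, b)` stays between the height `c` and the graph of `η`. -/
theorem lintegral_segment_le {u : WithLp 2 (E × ℝ) → ℝ} (hu : ContDiff ℝ 1 u) {η : E → ℝ}
    {c D : ℝ} (hc : 0 < c) {x y : E} {a b : ℝ}
    (hbelow : ∀ r ∈ Ioo (0 : ℝ) 1, c ≤ a + r * (b - a) ∧ a + r * (b - a) ≤ η (x + r • (y - x)))
    (hD : ‖y - x‖ + |b - a| ≤ D) :
    ∫⁻ t in Ioo (0 : ℝ) 1,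
        ‖u (WithLp.toLp 2 (y, b * t)) - u (WithLp.toLp 2 (x, a * t))‖ₑ ^ 2 ≤
      ENNReal.ofReal (D ^ 2 * c⁻¹) *
        ∫⁻ r in Ioo (0 : ℝ) 1, fiberEnergy u η (x + r • (y - x)) := by
  have hF := measurable_fderiv_toLp hu
  have hpoint : ∀ t ∈ Ioo (0 : ℝ) 1,
      ‖u (WithLp.toLp 2 (y, b * t)) - u (WithLp.toLp 2 (x, a * t))‖ₑ ^ 2 ≤
        ENNReal.ofReal (D ^ 2) * ∫⁻ r in Ioo (0 : ℝ) 1,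
          ‖fderiv ℝ u (WithLp.toLp 2 (x + r • (y - x), (a + r * (b - a)) * t))‖ₑ ^ 2 := by
    intro t ht
    refine (enorm_sub_sq_le_lintegral_fderiv hu _ _).trans ?_
    gcongr ?_ * ?_
    · rw [← ofReal_norm, ← ENNReal.ofReal_pow (norm_nonneg _)]
      gcongr
      refine le_trans ?_ hD
      rw [← WithLp.toLp_sub, Prod.mk_sub_mk]
      have hsq := WithLp.prod_norm_sq_eq_of_L2 (WithLp.toLp 2 (y - x, b * t - a * t))
      rw [← sub_mul] at hsq ⊢
      simp only [WithLp.toLp_fst, WithLp.toLp_snd, Real.norm_eq_abs, abs_mul, abs_of_pos ht.1] at hsq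
      have h₁ : |b - a| * t ≤ |b - a| := mul_le_of_le_one_right (abs_nonneg _) ht.2.le
      have h₂ : 0 ≤ |b - a| * t := mul_nonneg (abs_nonneg _) ht.1.le
      refine abs_le_of_sq_le_sq' ?_ (by positivity) |>.2
      nlinarith [norm_nonneg (y - x), abs_nonneg (b - a)]
    · refine lintegral_mono fun r => le_of_eq ?_
      congr 4
      rw [← WithLp.toLp_sub, ← WithLp.toLp_smul, ← WithLp.toLp_add]
      congr 1
      ext <;> simp
      ring
  calc _ ≤ ∫⁻ t in Ioo (0 : ℝ) 1, ENNReal.ofReal (D ^ 2) * ∫⁻ r in Ioo (0 : ℝ) 1,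
          ‖fderiv ℝ u (WithLp.toLp 2 (x + r • (y - x), (a + r * (b - a)) * t))‖ₑ ^ 2 :=
        setLIntegral_mono' measurableSet_Ioo hpoint
    _ = ENNReal.ofReal (D ^ 2) * ∫⁻ r in Ioo (0 : ℝ) 1, ∫⁻ t in Ioo (0 : ℝ) 1,
          ‖fderiv ℝ u (WithLp.toLp 2 (x + r • (y - x), (a + r * (b - a)) * t))‖ₑ ^ 2 := by
        rw [lintegral_const_mul' _ _ ENNReal.ofReal_ne_top, lintegral_lintegral_swap]
        exact (hF.comp (by fun_prop : Measurable fun p : ℝ × ℝ =>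
          (x + p.2 • (y - x), (a + p.2 * (b - a)) * p.1))).aemeasurable
    _ ≤ ENNReal.ofReal (D ^ 2) * ∫⁻ r in Ioo (0 : ℝ) 1,
          ENNReal.ofReal c⁻¹ * fiberEnergy u η (x + r • (y - x)) := by
        gcongr ENNReal.ofReal (D ^ 2) * ?_
        refine setLIntegral_mono' measurableSet_Ioo fun r hr => ?_
        exact lintegral_Ioo_comp_mul_le (hF.comp measurable_prodMk_left) hc
          (hbelow r hr).1 (hbelow r hr).2
    _ = _ := by
        rw [lintegral_const_mul' _ _ ENNReal.ofReal_ne_top, ← mul_assoc,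
          ENNReal.ofReal_mul (by positivity)]

/-- Uniform measure on the open unit interval together with unit masses at its endpoints. -/
noncomputable def segmentMeasure : Measure ℝ :=
  Measure.dirac 0 + Measure.dirac 1 + volume.restrict (Ioo 0 1)

instance : IsFiniteMeasure segmentMeasure := by
  unfold segmentMeasure; infer_instance

theorem lintegral_segmentMeasure (f : ℝ → ℝ≥0∞) :
    ∫⁻ r, f r ∂segmentMeasure = f 0 + f 1 + ∫⁻ r in Ioo 0 1, f r := by
  simp [segmentMeasure, lintegral_add_measure]

theorem enorm_sub_sq_le_three_mul (a b c d : ℝ) :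
    ‖a - d‖ₑ ^ 2 ≤ 3 * (‖b - a‖ₑ ^ 2 + ‖d - c‖ₑ ^ 2 + ‖c - b‖ₑ ^ 2) := by
  simp only [Real.enorm_eq_ofReal_abs, ← ENNReal.ofReal_pow (abs_nonneg _), sq_abs]
  rw [← ENNReal.ofReal_add (by positivity) (by positivity),
    ← ENNReal.ofReal_add (by positivity) (by positivity),
    ← ENNReal.ofReal_ofNat 3, ← ENNReal.ofReal_mul (by norm_num)]
  gcongr
  nlinarith [sq_nonneg (b - a - (d - c)), sq_nonneg (b - a - (c - b)),
    sq_nonneg (c - b - (d - c))]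

/-- Estimate along the path that descends from the graph of `η` over `x` to a height below `η` on
the whole segment `[x, y]`, moves horizontally to `y`, and ascends to the graph of `η`. -/
theorem lintegral_enorm_sub_sq_le {u : WithLp 2 (E × ℝ) → ℝ} (hu : ContDiff ℝ 1 u) {η : E → ℝ}
    {ω : Set E} (hconv : Convex ℝ ω) {α L c R : ℝ} (hα0 : 0 < α) (hα1 : α < 1) (hL : 0 ≤ L)
    (hc : 0 < c) (hHol : ∀ x ∈ ω, ∀ y ∈ ω, |η x - η y| ≤ L * ‖x - y‖ ^ α)
    (hlb : ∀ x ∈ ω, c ≤ η x) (hR : ∀ x ∈ ω, ∀ y ∈ ω, ‖y - x‖ ≤ R)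
    {x y : E} (hx : x ∈ ω) (hy : y ∈ ω) :
    ∫⁻ t in Ioo (0 : ℝ) 1,
        ‖u (WithLp.toLp 2 (x, η x * t)) - u (WithLp.toLp 2 (y, η y * t))‖ₑ ^ 2 ≤
      ENNReal.ofReal (3 * ((R ^ (1 - α) + 2 * L) ^ 2 * c⁻¹)) * (ENNReal.ofReal (‖y - x‖ ^ (2 * α)) *
        ∫⁻ r, ω.indicator (fiberEnergy u η) (x + r • (y - x)) ∂segmentMeasure) := by
  set δ := ‖y - x‖ ^ α with hδ
  set M := R ^ (1 - α) + 2 * L with hM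
  -- the height of the horizontal part of the path
  set a := max c (η x - L * δ) with ha
  have hδ0 : 0 ≤ δ := by positivity
  have hR0 : 0 ≤ R := (norm_nonneg _).trans (hR x hx y hy)
  have hLδ : 0 ≤ L * δ := by positivity
  have hRδ : 0 ≤ R ^ (1 - α) * δ := by positivity
  have hseg : ∀ r ∈ Icc (0 : ℝ) 1, x + r • (y - x) ∈ ω := fun r hr =>
    hconv.add_smul_sub_mem hx hy hr
  have hca : c ≤ a := le_max_left _ _
  have hxa : η x - L * δ ≤ a := le_max_right _ _
  have haη : ∀ r ∈ Icc (0 : ℝ) 1, a ≤ η (x + r • (y - x)) := fun r hr => by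
    refine max_le (hlb _ (hseg r hr)) ?_
    have h := hHol x hx _ (hseg r hr)
    have h' : ‖x - (x + r • (y - x))‖ ^ α ≤ δ := by
      refine Real.rpow_le_rpow (norm_nonneg _) ?_ hα0.le
      rw [sub_add_cancel_left, norm_neg, norm_smul, Real.norm_of_nonneg hr.1]
      exact mul_le_of_le_one_left (norm_nonneg _) hr.2
    have := mul_le_mul_of_nonneg_left h' hL
    linarith [le_abs_self (η x - η (x + r • (y - x)))]
  have hax : a ≤ η x := by simpa using haη 0 (by simp)
  have hay : a ≤ η y := by simpa using haη 1 (by simp)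
  have hyx : η y ≤ η x + L * δ := by
    have := hHol y hy x hx
    linarith [le_abs_self (η y - η x)]
  have hhor : ‖y - x‖ ≤ R ^ (1 - α) * δ := by
    calc ‖y - x‖ = ‖y - x‖ ^ (1 - α) * ‖y - x‖ ^ α := by
          rw [← Real.rpow_add' (norm_nonneg _) (by norm_num), sub_add_cancel, Real.rpow_one]
      _ ≤ _ := by
          gcongr
          exact hR x hx y hy
  have hconst : (M * δ) ^ 2 * c⁻¹ = M ^ 2 * c⁻¹ * ‖y - x‖ ^ (2 * α) := by
    rw [mul_comm 2 α, Real.rpow_mul (norm_nonneg _), mul_pow, ← hδ]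
    norm_num
    ring
  have h₁ : ∫⁻ t in Ioo (0 : ℝ) 1,
      ‖u (WithLp.toLp 2 (x, a * t)) - u (WithLp.toLp 2 (x, η x * t))‖ₑ ^ 2 ≤
        ENNReal.ofReal ((M * δ) ^ 2 * c⁻¹) * fiberEnergy u η x := by
    have := lintegral_segment_le (D := M * δ) hu hc (x := x) (y := x) (a := η x) (b := a)
      (η := η) (fun r hr => by
        simp only [sub_self, smul_zero, add_zero]
        constructor <;> nlinarith [hr.1, hr.2])
      (by rw [sub_self, norm_zero, zero_add, abs_of_nonpos (by linarith)]; nlinarith)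
    simpa using this
  have h₂ : ∫⁻ t in Ioo (0 : ℝ) 1,
      ‖u (WithLp.toLp 2 (y, η y * t)) - u (WithLp.toLp 2 (y, a * t))‖ₑ ^ 2 ≤
        ENNReal.ofReal ((M * δ) ^ 2 * c⁻¹) * fiberEnergy u η y := by
    have := lintegral_segment_le (D := M * δ) hu hc (x := y) (y := y) (a := a) (b := η y)
      (η := η) (fun r hr => by
        simp only [sub_self, smul_zero, add_zero]
        constructor <;> nlinarith [hr.1, hr.2])
      (by rw [sub_self, norm_zero, zero_add, abs_of_nonneg (by linarith)]; nlinarith)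
    simpa using this
  have h₃ := lintegral_segment_le (D := M * δ) hu hc (x := x) (y := y) (a := a) (b := a) (η := η)
    (fun r hr => by simpa using ⟨hca, haη r (Ioo_subset_Icc_self hr)⟩)
    (by rw [sub_self, abs_zero, add_zero]; nlinarith)
  have hmeas : ∀ (z w : E) (b d : ℝ), Measurable fun t : ℝ =>
      ‖u (WithLp.toLp 2 (z, b * t)) - u (WithLp.toLp 2 (w, d * t))‖ₑ ^ 2 := fun z w b d => by
    have hu' := hu.continuous
    refine Measurable.pow_const (Continuous.measurable ?_) 2
    fun_prop
  have hind : ∫⁻ r, ω.indicator (fiberEnergy u η) (x + r • (y - x)) ∂segmentMeasure =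
      fiberEnergy u η x + fiberEnergy u η y +
        ∫⁻ r in Ioo (0 : ℝ) 1, fiberEnergy u η (x + r • (y - x)) := by
    rw [lintegral_segmentMeasure]
    congr 1
    · simp [hx, hy]
    · exact setLIntegral_congr_fun measurableSet_Ioo fun r hr =>
        indicator_of_mem (hseg r (Ioo_subset_Icc_self hr)) _
  calc _ ≤ ∫⁻ t in Ioo (0 : ℝ) 1, 3 *
        (‖u (WithLp.toLp 2 (x, a * t)) - u (WithLp.toLp 2 (x, η x * t))‖ₑ ^ 2 +
          ‖u (WithLp.toLp 2 (y, η y * t)) - u (WithLp.toLp 2 (y, a * t))‖ₑ ^ 2 +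
          ‖u (WithLp.toLp 2 (y, a * t)) - u (WithLp.toLp 2 (x, a * t))‖ₑ ^ 2) :=
        lintegral_mono fun t => enorm_sub_sq_le_three_mul _ _ _ _
    _ ≤ 3 * (ENNReal.ofReal ((M * δ) ^ 2 * c⁻¹) * fiberEnergy u η x +
          ENNReal.ofReal ((M * δ) ^ 2 * c⁻¹) * fiberEnergy u η y +
          ENNReal.ofReal ((M * δ) ^ 2 * c⁻¹) *
            ∫⁻ r in Ioo (0 : ℝ) 1, fiberEnergy u η (x + r • (y - x))) := by
        rw [lintegral_const_mul' _ _ (by norm_num), lintegral_add_right _ (hmeas _ _ _ _),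
          lintegral_add_right _ (hmeas _ _ _ _)]
        gcongr
    _ = _ := by
        have hMc : 0 ≤ M ^ 2 * c⁻¹ := mul_nonneg (sq_nonneg M) (inv_nonneg.2 hc.le)
        rw [hind, hconst, ENNReal.ofReal_mul hMc, ENNReal.ofReal_mul (p := 3) (by norm_num),
          ENNReal.ofReal_ofNat]
        ring

variable [FiniteDimensional ℝ E]

theorem lintegral_kernel_mul_segment {k g : E → ℝ≥0∞} (hk : Measurable k) (hg : Measurable g)
    (ν : Measure ℝ) [SFinite ν] :
    ∫⁻ x, ∫⁻ y, k (y - x) * ∫⁻ r, g (x + r • (y - x)) ∂ν =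
      (∫⁻ h, k h) * (ν univ * ∫⁻ x, g x) := by
  have hmeas : Measurable fun p : E × E => ∫⁻ r, g (p.1 + r • p.2) ∂ν :=
    Measurable.lintegral_prod_right' (f := fun q : (E × E) × ℝ => g (q.1.1 + q.2 • q.1.2))
      (hg.comp (by fun_prop))
  calc _ = ∫⁻ x, ∫⁻ h, k h * ∫⁻ r, g (x + r • h) ∂ν := by
        congr with x
        exact lintegral_sub_right_eq_self (fun h => k h * ∫⁻ r, g (x + r • h) ∂ν) x
    _ = ∫⁻ h, ∫⁻ x, k h * ∫⁻ r, g (x + r • h) ∂ν :=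
        lintegral_lintegral_swap ((hk.comp measurable_snd).mul hmeas).aemeasurable
    _ = ∫⁻ h, k h * (ν univ * ∫⁻ x, g x) := by
        congr with h
        have hmeas_h : Measurable fun x : E => ∫⁻ r, g (x + r • h) ∂ν :=
          hmeas.comp measurable_prodMk_right
        have hmeas_hr : Measurable (Function.uncurry fun (x : E) (r : ℝ) => g (x + r • h)) :=
          hg.comp (by fun_prop)
        rw [lintegral_const_mul _ hmeas_h, lintegral_lintegral_swap hmeas_hr.aemeasurable]
        simp_rw [lintegral_add_right_eq_self g, lintegral_const, mul_comm]
    _ = _ := lintegral_mul_const _ hk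

theorem integrableOn_norm_rpow_mul_inv [Nontrivial E] {β s : ℝ} (hsβ : s < β) (R : ℝ) :
    IntegrableOn (fun h : E => ‖h‖ ^ (2 * β) * (‖h‖ ^ ((Module.finrank ℝ E : ℝ) + 2 * s))⁻¹)
      (Metric.ball 0 R) := by
  rw [integrableOn_fun_norm_addHaar volume
    (f := fun y : ℝ => y ^ (2 * β) * (y ^ ((Module.finrank ℝ E : ℝ) + 2 * s))⁻¹)]
  have hint : IntegrableOn (fun y : ℝ => y ^ (2 * (β - s) - 1)) (Ioo 0 R) := by
    rcases le_or_gt R 0 with hR | hR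
    · simp [Ioo_eq_empty (not_lt.2 hR)]
    · exact (intervalIntegral.integrableOn_Ioo_rpow_iff hR).2 (by linarith)
  refine hint.congr_fun (fun y hy => ?_) measurableSet_Ioo
  have hdim : 1 ≤ Module.finrank ℝ E := Module.finrank_pos
  simp only [smul_eq_mul]
  rw [← Real.rpow_natCast, ← Real.rpow_neg hy.1.le, ← Real.rpow_add hy.1, ← Real.rpow_add hy.1]
  congr 1
  push_cast [hdim]
  ring

theorem lintegral_lintegral_lintegral_rotate {X Y Z : Type*} [MeasurableSpace X]
    [MeasurableSpace Y] [MeasurableSpace Z] {μ : Measure X} {ν : Measure Y} {ρ : Measure Z}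
    [SFinite μ] [SFinite ν] [SFinite ρ] {f : X → Y → Z → ℝ≥0∞}
    (hf : Measurable fun q : (X × Y) × Z => f q.1.1 q.1.2 q.2) :
    ∫⁻ x, ∫⁻ y, ∫⁻ z, f x y z ∂ρ ∂ν ∂μ = ∫⁻ y, ∫⁻ z, ∫⁻ x, f x y z ∂μ ∂ρ ∂ν := by
  rw [lintegral_lintegral_swap hf.lintegral_prod_right'.aemeasurable]
  refine lintegral_congr fun y => lintegral_lintegral_swap ?_
  exact (hf.comp (by fun_prop : Measurable fun q : X × Z => ((q.1, y), q.2))).aemeasurable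

/-- The fractional seminorm estimate in terms of lower integrals. -/
theorem exists_lintegral_gagliardo_le [Nontrivial E] {η : E → ℝ} (hη : Measurable η) {ω : Set E}
    (hω : MeasurableSet ω) (hconv : Convex ℝ ω) {α s L c R : ℝ} (hα0 : 0 < α) (hα1 : α < 1)
    (hsα : s < α) (hL : 0 ≤ L) (hc : 0 < c)
    (hHol : ∀ x ∈ ω, ∀ y ∈ ω, |η x - η y| ≤ L * ‖x - y‖ ^ α)
    (hlb : ∀ x ∈ ω, c ≤ η x) (hR : ∀ x ∈ ω, ∀ y ∈ ω, ‖y - x‖ ≤ R) :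
    ∃ C : ℝ≥0∞, C ≠ ∞ ∧ ∀ u : WithLp 2 (E × ℝ) → ℝ, ContDiff ℝ 1 u →
      ∫⁻ t in Ioo (0 : ℝ) 1, ∫⁻ x in ω, ∫⁻ y in ω,
        ENNReal.ofReal (‖y - x‖ ^ ((Module.finrank ℝ E : ℝ) + 2 * s))⁻¹ *
          ‖u (WithLp.toLp 2 (x, η x * t)) - u (WithLp.toLp 2 (y, η y * t))‖ₑ ^ 2 ≤
      C * ∫⁻ x in ω, fiberEnergy u η x := by
  set p : ℝ := (Module.finrank ℝ E : ℝ) + 2 * s with hp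
  set K := ENNReal.ofReal (3 * ((R ^ (1 - α) + 2 * L) ^ 2 * c⁻¹)) with hK
  set k : E → ℝ≥0∞ := (Metric.ball 0 (R + 1)).indicator fun h =>
    ENNReal.ofReal (‖h‖ ^ (2 * α) * (‖h‖ ^ p)⁻¹) with hk
  have hkm : Measurable k := Measurable.indicator (by fun_prop) measurableSet_ball
  have hkint : ∫⁻ h, k h ≠ ∞ := by
    rw [hk, lintegral_indicator measurableSet_ball]
    exact (integrableOn_norm_rpow_mul_inv hsα (R + 1)).lintegral_lt_top.ne
  refine ⟨K * ((∫⁻ h, k h) * segmentMeasure univ),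
    ENNReal.mul_ne_top ENNReal.ofReal_ne_top (ENNReal.mul_ne_top hkint (measure_ne_top _ _)),
    fun u hu => ?_⟩
  have hg : Measurable (ω.indicator (fiberEnergy u η)) := (measurable_fiberEnergy hu hη).indicator hω
  have hf : Measurable fun q : (ℝ × E) × E => ENNReal.ofReal (‖q.2 - q.1.2‖ ^ p)⁻¹ *
      ‖u (WithLp.toLp 2 (q.1.2, η q.1.2 * q.1.1)) -
        u (WithLp.toLp 2 (q.2, η q.2 * q.1.1))‖ₑ ^ 2 := by
    have hu' : Measurable fun z : E × ℝ => u (WithLp.toLp 2 z) :=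
      (hu.continuous.comp (WithLp.prod_continuous_toLp 2 E ℝ)).measurable
    refine Measurable.mul (by fun_prop) (Measurable.pow_const (Measurable.enorm ?_) 2)
    exact (hu'.comp (by fun_prop : Measurable fun q : (ℝ × E) × E => (q.1.2, η q.1.2 * q.1.1))).sub
      (hu'.comp (by fun_prop : Measurable fun q : (ℝ × E) × E => (q.2, η q.2 * q.1.1)))
  calc _ = ∫⁻ x in ω, ∫⁻ y in ω, ENNReal.ofReal (‖y - x‖ ^ p)⁻¹ * ∫⁻ t in Ioo (0 : ℝ) 1,
          ‖u (WithLp.toLp 2 (x, η x * t)) - u (WithLp.toLp 2 (y, η y * t))‖ₑ ^ 2 := by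
        rw [lintegral_lintegral_lintegral_rotate hf]
        simp_rw [lintegral_const_mul' _ _ ENNReal.ofReal_ne_top]
    _ ≤ ∫⁻ x in ω, ∫⁻ y in ω, K * (k (y - x) *
          ∫⁻ r, ω.indicator (fiberEnergy u η) (x + r • (y - x)) ∂segmentMeasure) := by
        refine setLIntegral_mono' hω fun x hx => setLIntegral_mono' hω fun y hy => ?_
        have hball : y - x ∈ Metric.ball 0 (R + 1) := by
          rw [mem_ball_zero_iff]; linarith [hR x hx y hy]
        rw [hk, indicator_of_mem hball, ENNReal.ofReal_mul (by positivity)]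
        refine (mul_le_mul_right (lintegral_enorm_sub_sq_le hu hconv hα0 hα1 hL hc hHol hlb hR hx hy)
          _).trans (le_of_eq ?_)
        ring
    _ ≤ ∫⁻ x, ∫⁻ y, K * (k (y - x) *
          ∫⁻ r, ω.indicator (fiberEnergy u η) (x + r • (y - x)) ∂segmentMeasure) :=
        (setLIntegral_le_lintegral _ _).trans
          (lintegral_mono fun x => setLIntegral_le_lintegral _ _)
    _ = _ := by
        simp_rw [lintegral_const_mul' K _ ENNReal.ofReal_ne_top]
        rw [lintegral_kernel_mul_segment hkm hg, lintegral_indicator hω]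
        ring

theorem ofReal_integral_le_lintegral_ofReal {X : Type*} [MeasurableSpace X] {μ : Measure X}
    {f : X → ℝ} (hf : ∀ x, 0 ≤ f x) :
    ENNReal.ofReal (∫ x, f x ∂μ) ≤ ∫⁻ x, ENNReal.ofReal (f x) ∂μ := by
  have h := enorm_integral_le_lintegral_enorm (μ := μ) f
  simpa only [Real.enorm_of_nonneg (integral_nonneg hf), Real.enorm_of_nonneg (hf _)] using h

theorem norm_gradient {F : Type*} [NormedAddCommGroup F] [InnerProductSpace ℝ F] [CompleteSpace F]
    (u : F → ℝ) (z : F) : ‖gradient u z‖ = ‖fderiv ℝ u z‖ :=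
  LinearIsometryEquiv.norm_map _ _

theorem hasCompactSupport_norm_fderiv_sq {V : Type*} [NormedAddCommGroup V] [NormedSpace ℝ V]
    {u : V → ℝ} (hu : HasCompactSupport u) :
    HasCompactSupport fun z => ‖fderiv ℝ u z‖ ^ 2 :=
  (hu.fderiv ℝ).comp_left (g := fun T => ‖T‖ ^ 2) (by simp)

theorem lintegral_fderiv_eq_ofReal_integral {u : WithLp 2 (E × ℝ) → ℝ} (hu : ContDiff ℝ 1 u)
    (hsupp : HasCompactSupport u) (Ω : Set (E × ℝ)) :
    ∫⁻ p in Ω, ‖fderiv ℝ u (WithLp.toLp 2 p)‖ₑ ^ 2 =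
      ENNReal.ofReal (∫ p in Ω, ‖gradient u (WithLp.toLp 2 p)‖ ^ 2) := by
  have hcont : Continuous fun p : E × ℝ => ‖fderiv ℝ u (WithLp.toLp 2 p)‖ ^ 2 :=
    ((hu.continuous_fderiv one_ne_zero).comp (WithLp.prod_continuous_toLp 2 E ℝ)).norm.pow 2
  have hcomp : HasCompactSupport fun p : E × ℝ => ‖fderiv ℝ u (WithLp.toLp 2 p)‖ ^ 2 :=
    (hasCompactSupport_norm_fderiv_sq hsupp).comp_homeomorph (WithLp.homeomorphProd 2 E ℝ).symm
  simp_rw [norm_gradient]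
  rw [ofReal_integral_eq_lintegral_ofReal (hcont.integrable_of_hasCompactSupport hcomp).integrableOn
    (ae_of_all _ fun p => by positivity)]
  congr with p
  rw [ENNReal.ofReal_pow (norm_nonneg (fderiv ℝ u (WithLp.toLp 2 p))), ofReal_norm]

end Helpers

/-- the key estimate `∫₀¹ [ū(·,t)]²_{H^s(ω)} dt ≤ C ‖∇u‖²_{L²(Ω_η)}` for
`u ∈ C¹_c(ℝⁿ)` and `0 ≤ s < α`, on the subgraph domain of a Hölder function `η`. Here the
ambient space `ℝⁿ = ℝ^{n-1} × ℝ` carries the Euclidean (ℓ²) structure. -/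
theorem stmt12 (n : ℕ) (hn : 2 ≤ n) (ω : Set (EuclideanSpace ℝ (Fin (n - 1))))
    (hopen : IsOpen ω) (hconv : Convex ℝ ω) (hbdd : Bornology.IsBounded ω)
    (α s L ηmin : ℝ) (hα0 : 0 < α) (hα1 : α < 1) (hs : 0 ≤ s) (hsα : s < α)
    (hL : 0 ≤ L) (hηmin : 0 < ηmin)
    (η : EuclideanSpace ℝ (Fin (n - 1)) → ℝ)
    (hHol : ∀ x ∈ closure ω, ∀ y ∈ closure ω, |η x - η y| ≤ L * ‖x - y‖ ^ α)
    (hlb : ∀ x ∈ closure ω, ηmin ≤ η x) :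
    ∃ C > 0, ∀ u : WithLp 2 (EuclideanSpace ℝ (Fin (n - 1)) × ℝ) → ℝ,
      ContDiff ℝ 1 u → HasCompactSupport u →
      ∫ t in (0:ℝ)..1, ∫ x₁ in ω, ∫ x₂ in ω,
          |u ((WithLp.equiv 2 (EuclideanSpace ℝ (Fin (n - 1)) × ℝ)).symm (x₁, η x₁ * t)) -
            u ((WithLp.equiv 2 (EuclideanSpace ℝ (Fin (n - 1)) × ℝ)).symm (x₂, η x₂ * t))| ^ 2 /
            ‖x₁ - x₂‖ ^ (((n:ℝ) - 1) + 2*s) ≤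
        C * ∫ p in {p : EuclideanSpace ℝ (Fin (n - 1)) × ℝ | p.1 ∈ ω ∧ p.2 ∈ Ioo 0 (η p.1)},
          ‖gradient u ((WithLp.equiv 2 (EuclideanSpace ℝ (Fin (n - 1)) × ℝ)).symm p)‖ ^ 2 := by
  have : Nontrivial (EuclideanSpace ℝ (Fin (n - 1))) := by
    have : Nonempty (Fin (n - 1)) := ⟨⟨0, by omega⟩⟩
    infer_instance
  have hsub : ω ⊆ closure ω := subset_closure
  have hω : MeasurableSet ω := hopen.measurableSet
  obtain ⟨R, hR⟩ := hbdd.exists_norm_le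
  have hηcont : ContinuousOn η ω := by
    intro x hx
    refine tendsto_iff_norm_sub_tendsto_zero.2 (squeeze_zero' (g := fun y => L * ‖y - x‖ ^ α)
      (Filter.Eventually.of_forall fun y => norm_nonneg _)
      (eventually_nhdsWithin_of_forall fun y hy => hHol y (hsub hy) x (hsub hx)) ?_)
    have h : ContinuousAt (fun y => L * ‖y - x‖ ^ α) x :=
      continuousAt_const.mul (ContinuousAt.rpow_const (by fun_prop) (Or.inr hα0.le))
    simpa [Real.zero_rpow hα0.ne'] using h.continuousWithinAt.tendsto
  -- only the values of `η` on `ω` matter, so it may be replaced by a measurable function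
  have hη' : Measurable (ω.indicator η) := by
    classical
    rw [← piecewise_eq_indicator]
    exact hηcont.measurable_piecewise continuousOn_const hω
  have heq : ∀ x ∈ ω, ω.indicator η x = η x := fun x hx => indicator_of_mem hx _
  obtain ⟨C, hC, hmain⟩ := exists_lintegral_gagliardo_le hη' hω hconv (s := s) (c := ηmin)
    (R := R + R) hα0 hα1 hsα hL hηmin
    (fun x hx y hy => by rw [heq x hx, heq y hy]; exact hHol x (hsub hx) y (hsub hy))
    (fun x hx => by rw [heq x hx]; exact hlb x (hsub hx))
    (fun x hx y hy => (norm_sub_le y x).trans (add_le_add (hR y hy) (hR x hx)))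
  refine ⟨C.toReal + 1, by positivity, fun u hu hsupp => ?_⟩
  simp only [WithLp.equiv_symm_apply]
  have hΩ : {p : EuclideanSpace ℝ (Fin (n - 1)) × ℝ | p.1 ∈ ω ∧ p.2 ∈ Ioo 0 (ω.indicator η p.1)} =
      {p | p.1 ∈ ω ∧ p.2 ∈ Ioo 0 (η p.1)} := by
    ext p
    exact and_congr_right fun hp => by rw [heq _ hp]
  have hbound := hmain u hu
  rw [lintegral_fiberEnergy hu hη' hω, lintegral_fderiv_eq_ofReal_integral hu hsupp, hΩ] at hbound
  set I := ∫ p in {p : EuclideanSpace ℝ (Fin (n - 1)) × ℝ | p.1 ∈ ω ∧ p.2 ∈ Ioo 0 (η p.1)},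
    ‖gradient u (WithLp.toLp 2 p)‖ ^ 2 with hI
  have hI0 : 0 ≤ I := integral_nonneg fun p => by positivity
  have hdim : (Module.finrank ℝ (EuclideanSpace ℝ (Fin (n - 1))) : ℝ) = (n : ℝ) - 1 := by
    rw [finrank_euclideanSpace_fin, Nat.cast_sub (by omega), Nat.cast_one]
  rw [hdim] at hbound
  rw [intervalIntegral.integral_of_le zero_le_one, integral_Ioc_eq_integral_Ioo]
  refine (ENNReal.ofReal_le_ofReal_iff (by positivity)).1 ?_
  calc _ ≤ ∫⁻ t in Ioo (0 : ℝ) 1, ∫⁻ x₁ in ω, ∫⁻ x₂ in ω, ENNReal.ofReal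
          (|u (WithLp.toLp 2 (x₁, η x₁ * t)) - u (WithLp.toLp 2 (x₂, η x₂ * t))| ^ 2 /
            ‖x₁ - x₂‖ ^ (((n : ℝ) - 1) + 2 * s)) := by
        have h₀ : ∀ (t : ℝ) (x₁ x₂ : EuclideanSpace ℝ (Fin (n - 1))),
            0 ≤ |u (WithLp.toLp 2 (x₁, η x₁ * t)) - u (WithLp.toLp 2 (x₂, η x₂ * t))| ^ 2 /
              ‖x₁ - x₂‖ ^ (((n : ℝ) - 1) + 2 * s) := fun t x₁ x₂ => by positivity
        refine (ofReal_integral_le_lintegral_ofReal fun t =>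
          integral_nonneg fun x₁ => integral_nonneg (h₀ t x₁)).trans (lintegral_mono fun t => ?_)
        refine (ofReal_integral_le_lintegral_ofReal fun x₁ =>
          integral_nonneg (h₀ t x₁)).trans (lintegral_mono fun x₁ => ?_)
        exact ofReal_integral_le_lintegral_ofReal (h₀ t x₁)
    _ = ∫⁻ t in Ioo (0 : ℝ) 1, ∫⁻ x in ω, ∫⁻ y in ω,
          ENNReal.ofReal (‖y - x‖ ^ (((n : ℝ) - 1) + 2 * s))⁻¹ *
            ‖u (WithLp.toLp 2 (x, ω.indicator η x * t)) -
              u (WithLp.toLp 2 (y, ω.indicator η y * t))‖ₑ ^ 2 := by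
        refine lintegral_congr fun t => setLIntegral_congr_fun hω fun x hx =>
          setLIntegral_congr_fun hω fun y hy => ?_
        simp only [heq x hx, heq y hy]
        rw [div_eq_inv_mul, ENNReal.ofReal_mul (by positivity), norm_sub_rev,
          ENNReal.ofReal_pow (abs_nonneg _), Real.enorm_eq_ofReal_abs]
    _ ≤ C * ENNReal.ofReal I := hbound
    _ ≤ ENNReal.ofReal ((C.toReal + 1) * I) := by
        rw [ENNReal.ofReal_mul (by positivity)]
        gcongr
        rw [← ENNReal.ofReal_toReal hC]
        exact ENNReal.ofReal_le_ofReal (by rw [ENNReal.toReal_ofReal ENNReal.toReal_nonneg]; linarith)
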